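/- Let k ∈ ℤ with k ≤ 0. For every smooth function f : ℍ → ℂ, ξ_k(𝔉_k f) = (1/(−k)!) · R_k^{1−k} f; equivalently, by Bol's identity, ξ_k(𝔉_k f) = ((−4π)^{1−k}/(−k)!) · D^{1−k} f. -/

import Mathlib

open Complex

noncomputable section

/-- The upper half-plane, as a subset of `ℂ`. -/
def UH : Set ℂ := {z : ℂ | 0 < z.im}

/-- Partial derivative in the direction of the real axis, `∂f/∂u`. -/
noncomputable def du (f : ℂ → ℂ) (z : ℂ) : ℂ := fderiv ℝ f z 1

/-- Partial derivative in the direction of the imaginary axis, `∂f/∂v`. -/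
noncomputable def dv (f : ℂ → ℂ) (z : ℂ) : ℂ := fderiv ℝ f z Complex.I

/-- The Wirtinger derivative `∂_τ f = (1/2)(∂f/∂u − i ∂f/∂v)`. -/
noncomputable def dtau (f : ℂ → ℂ) (z : ℂ) : ℂ :=
  (1 / 2) * (du f z - Complex.I * dv f z)

/-- The Wirtinger derivative `∂_τ̄ f = (1/2)(∂f/∂u + i ∂f/∂v)`. -/
noncomputable def dtauBar (f : ℂ → ℂ) (z : ℂ) : ℂ :=
  (1 / 2) * (du f z + Complex.I * dv f z)

/-- The Maass raising operator `R_k f = 2i ∂_τ f + (k/v) f`. -/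
noncomputable def Rop (k : ℤ) (f : ℂ → ℂ) (z : ℂ) : ℂ :=
  2 * Complex.I * dtau f z + ((k : ℂ) / (z.im : ℂ)) * f z

/-- The Maass lowering operator `L_k f = −2i v² ∂_τ̄ f`. -/
noncomputable def Lop (_k : ℤ) (f : ℂ → ℂ) (z : ℂ) : ℂ :=
  -2 * Complex.I * (z.im : ℂ) ^ 2 * dtauBar f z

/-- The weight-`k` hyperbolic Laplacian
`Δ_k f = −v²(∂²f/∂u² + ∂²f/∂v²) + i k v (∂f/∂u + i ∂f/∂v)`. -/
noncomputable def Lap (k : ℤ) (f : ℂ → ℂ) (z : ℂ) : ℂ :=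
  -(z.im : ℂ) ^ 2 * (du (du f) z + dv (dv f) z)
    + Complex.I * (k : ℂ) * (z.im : ℂ) * (du f z + Complex.I * dv f z)

/-- Iterated raising operator `R_k^r = R_{k+2(r−1)} ∘ ⋯ ∘ R_{k+2} ∘ R_k`, `R_k^0 = id`. -/
noncomputable def Riter (k : ℤ) : ℕ → (ℂ → ℂ) → ℂ → ℂ
  | 0, f => f
  | r + 1, f => Rop (k + 2 * (r : ℤ)) (Riter k r f)

/-- Iterated lowering operator `L_k^r = L_{k−2(r−1)} ∘ ⋯ ∘ L_{k−2} ∘ L_k`, `L_k^0 = id`. -/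
noncomputable def Liter (k : ℤ) : ℕ → (ℂ → ℂ) → ℂ → ℂ
  | 0, f => f
  | r + 1, f => Lop (k - 2 * (r : ℤ)) (Liter k r f)

/-- The Bruinier–Funke operator `ξ_k f = 2i v^k ⋅ conj(∂_τ̄ f)`. -/
noncomputable def xiop (k : ℤ) (f : ℂ → ℂ) (z : ℂ) : ℂ :=
  2 * Complex.I * (z.im : ℂ) ^ k * (starRingEnd ℂ) (dtauBar f z)

/-- The operator `D f = (1/(2πi)) ∂_τ f`. -/
noncomputable def Dop (f : ℂ → ℂ) (z : ℂ) : ℂ :=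
  (1 / (2 * (Real.pi : ℂ) * Complex.I)) * dtau f z

/-- The `n`-fold iterate `D^n`. -/
noncomputable def Diter : ℕ → (ℂ → ℂ) → ℂ → ℂ
  | 0, f => f
  | n + 1, f => Dop (Diter n f)

/-- The flipping operator `𝔉_k f = (v^{−k}/(−k)!) ⋅ conj(R_k^{−k} f)`, for `k ≤ 0`. -/
noncomputable def flipOp (k : ℤ) (f : ℂ → ℂ) (z : ℂ) : ℂ :=
  ((z.im : ℂ) ^ (-k) / ((-k).toNat.factorial : ℂ)) *
    (starRingEnd ℂ) (Riter k (-k).toNat f z)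

theorem isOpen_UH : IsOpen UH := isOpen_lt continuous_const continuous_im

theorem UH_mem_nhds {z : ℂ} (hz : z ∈ UH) : UH ∈ nhds z := isOpen_UH.mem_nhds hz

theorem im_ne_zero_of_mem_UH {z : ℂ} (hz : z ∈ UH) : (z.im : ℂ) ≠ 0 :=
  ofReal_ne_zero.mpr (ne_of_gt hz)

theorem ContDiffOn.differentiableAt_of_mem_UH {f : ℂ → ℂ} (hf : ContDiffOn ℝ (⊤ : ℕ∞) f UH)
    {z : ℂ} (hz : z ∈ UH) : DifferentiableAt ℝ f z :=
  (hf.contDiffAt (UH_mem_nhds hz)).differentiableAt (by simp)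

theorem hasFDerivAt_im (z : ℂ) :
    HasFDerivAt (fun w : ℂ => (w.im : ℂ)) (ofRealCLM.comp imCLM) z :=
  (ofRealCLM.comp imCLM).hasFDerivAt

theorem contDiffOn_const_div_im (c : ℂ) :
    ContDiffOn ℝ (⊤ : ℕ∞) (fun z : ℂ => c / (z.im : ℂ)) UH :=
  contDiffOn_const.mul ((ofRealCLM.comp imCLM).contDiff.contDiffOn.inv
    fun _ hz => im_ne_zero_of_mem_UH hz)

theorem dtau_congr {f g : ℂ → ℂ} (h : Set.EqOn f g UH) {z : ℂ} (hz : z ∈ UH) :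
    dtau f z = dtau g z := by
  have : fderiv ℝ f z = fderiv ℝ g z :=
    (h.eventuallyEq_of_mem (UH_mem_nhds hz)).fderiv_eq
  simp only [dtau, du, dv, this]

theorem dtau_add {f g : ℂ → ℂ} {z : ℂ} (hf : DifferentiableAt ℝ f z)
    (hg : DifferentiableAt ℝ g z) :
    dtau (fun w => f w + g w) z = dtau f z + dtau g z := by
  simp only [dtau, du, dv, fderiv_fun_add hf hg, add_apply]
  ring

theorem dtau_mul {f g : ℂ → ℂ} {z : ℂ} (hf : DifferentiableAt ℝ f z)
    (hg : DifferentiableAt ℝ g z) :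
    dtau (fun w => f w * g w) z = f z * dtau g z + g z * dtau f z := by
  simp only [dtau, du, dv, fderiv_fun_mul hf hg, add_apply,
    smul_apply, smul_eq_mul]
  ring

theorem dtau_const_mul (c : ℂ) (f : ℂ → ℂ) (z : ℂ) :
    dtau (fun w => c * f w) z = c * dtau f z := by
  have : fderiv ℝ (fun w => c * f w) z = c • fderiv ℝ f z :=
    congrFun (fderiv_const_smul_field (𝕜 := ℝ) (f := f) c) z
  simp only [dtau, du, dv, this, smul_apply, smul_eq_mul]
  ring

theorem dtau_const_div_im (c : ℂ) {z : ℂ} (hz : z ∈ UH) :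
    dtau (fun w => c / (w.im : ℂ)) z = I / 2 * c / (z.im : ℂ) ^ 2 := by
  have h : HasFDerivAt (fun w : ℂ => c / (w.im : ℂ)) _ z :=
    ((hasFDerivAt_inv' (im_ne_zero_of_mem_UH hz)).comp z (hasFDerivAt_im z)).const_mul c
  simp only [dtau, du, dv, h.fderiv]
  simp
  ring

theorem contDiffOn_Rop (k : ℤ) {f : ℂ → ℂ} (hf : ContDiffOn ℝ (⊤ : ℕ∞) f UH) :
    ContDiffOn ℝ (⊤ : ℕ∞) (Rop k f) UH := by
  have h : ContDiffOn ℝ (⊤ : ℕ∞) (fderiv ℝ f) UH :=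
    hf.fderiv_of_isOpen isOpen_UH (by simp)
  have hdu : ContDiffOn ℝ (⊤ : ℕ∞) (du f) UH := h.clm_apply contDiffOn_const
  have hdv : ContDiffOn ℝ (⊤ : ℕ∞) (dv f) UH := h.clm_apply contDiffOn_const
  exact (contDiffOn_const.mul
    (contDiffOn_const.mul (hdu.sub (contDiffOn_const.mul hdv)))).add
    ((contDiffOn_const_div_im k).mul hf)

theorem contDiffOn_Riter (k : ℤ) (r : ℕ) {f : ℂ → ℂ} (hf : ContDiffOn ℝ (⊤ : ℕ∞) f UH) :
    ContDiffOn ℝ (⊤ : ℕ∞) (Riter k r f) UH := by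
  induction r with
  | zero => exact hf
  | succ r ih => exact contDiffOn_Rop _ ih

/-- Commutation of the iterated raising operator past `Rop 0 = 2i ∂_τ`. -/
theorem Riter_succ_eq (k : ℤ) (r : ℕ) {f : ℂ → ℂ} (hf : ContDiffOn ℝ (⊤ : ℕ∞) f UH) :
    Set.EqOn (Riter k (r + 1) f)
      (fun z => Riter (k + 1) r (Rop 0 f) z + ((k + r : ℂ) / z.im) * Riter k r f z) UH := by
  induction r with
  | zero =>
    intro z _
    simp [Riter, Rop]
  | succ r ih =>
    intro z hz
    have hv := im_ne_zero_of_mem_UH hz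
    have hA := (contDiffOn_Riter (k + 1) r
      (contDiffOn_Rop 0 hf)).differentiableAt_of_mem_UH hz
    have hB := (contDiffOn_Riter k r hf).differentiableAt_of_mem_UH hz
    have hc := (contDiffOn_const_div_im (k + r : ℂ)).differentiableAt_of_mem_UH hz
    have hd := dtau_congr ih hz
    rw [dtau_add hA (hc.fun_mul hB), dtau_mul hc hB, dtau_const_div_im _ hz] at hd
    have hz' : Riter k (r + 1) f z = Riter (k + 1) r (Rop 0 f) z
        + ((k + r : ℂ) / z.im) * Riter k r f z := ih hz
    have h₁ : Riter k (r + 2) f z = 2 * I * dtau (Riter k (r + 1) f) z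
        + ((k + 2 * (r + 1 : ℕ) : ℤ) : ℂ) / z.im * Riter k (r + 1) f z := rfl
    have h₂ : Riter (k + 1) (r + 1) (Rop 0 f) z = 2 * I * dtau (Riter (k + 1) r (Rop 0 f)) z
        + ((k + 1 + 2 * r : ℤ) : ℂ) / z.im * Riter (k + 1) r (Rop 0 f) z := rfl
    have h₃ : Riter k (r + 1) f z = 2 * I * dtau (Riter k r f) z
        + ((k + 2 * r : ℤ) : ℂ) / z.im * Riter k r f z := rfl
    have h₄ : 2 * I * dtau (Riter k r f) z = Riter (k + 1) r (Rop 0 f) z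
        + ((k + r : ℂ) / z.im) * Riter k r f z
        - ((k + 2 * r : ℤ) : ℂ) / z.im * Riter k r f z := by
      rw [← hz', h₃]; ring
    beta_reduce
    rw [h₁, h₂, hd, hz']
    push_cast at h₄ ⊢
    linear_combination ((k + r : ℂ) / z.im) * h₄
      + ((k + r : ℂ) / (z.im : ℂ) ^ 2 * Riter k r f z) * I_sq

/-- Bol's identity for the raising operator. -/
theorem Riter_neg_eq_iterate (n : ℕ) {f : ℂ → ℂ} (hf : ContDiffOn ℝ (⊤ : ℕ∞) f UH) :
    Set.EqOn (Riter (-n) (n + 1) f) ((Rop 0)^[n + 1] f) UH := by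
  induction n generalizing f with
  | zero =>
    intro z _
    simp [Riter]
  | succ n ih =>
    intro z hz
    rw [Riter_succ_eq _ _ hf hz, Function.iterate_succ_apply, ← ih (contDiffOn_Rop 0 hf) hz]
    have : -((n + 1 : ℕ) : ℤ) + 1 = -n := by push_cast; ring
    rw [this]
    simp

theorem iterate_Rop_zero_eq_Diter (n : ℕ) (f : ℂ → ℂ) :
    (Rop 0)^[n] f = fun z => (-4 * (Real.pi : ℂ)) ^ n * Diter n f z := by
  induction n with
  | zero => simp [Diter]
  | succ n ih =>
    funext z
    have hpi : (Real.pi : ℂ) ≠ 0 := ofReal_ne_zero.mpr Real.pi_ne_zero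
    rw [Function.iterate_succ_apply', ih]
    simp only [Rop, Diter, Dop, dtau_const_mul]
    field_simp
    simp [pow_succ]
    ring_nf
    simp

/-- The flipped function is mapped by `ξ_{-n}` to a multiple of `R_{-n}^{n+1} f`. -/
theorem xiop_flipOp (n : ℕ) {f : ℂ → ℂ} (hf : ContDiffOn ℝ (⊤ : ℕ∞) f UH) {z : ℂ}
    (hz : z ∈ UH) :
    xiop (-n) (flipOp (-n) f) z
      = (1 / (n.factorial : ℂ)) * Riter (-n) (n + 1) f z := by
  have hv := im_ne_zero_of_mem_UH hz
  have hn : (n.factorial : ℂ) ≠ 0 := Nat.cast_ne_zero.mpr n.factorial_ne_zero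
  have hh := ((contDiffOn_Riter (-n) n hf).differentiableAt_of_mem_UH hz).hasFDerivAt
  have hF : flipOp (-n) f = fun w : ℂ => ((n.factorial : ℂ)⁻¹ * (w.im : ℂ) ^ n) *
      (starRingEnd ℂ) (Riter (-n) n f w) := by
    funext w
    simp [flipOp, div_eq_inv_mul]
  have hd : HasFDerivAt (fun w : ℂ => ((n.factorial : ℂ)⁻¹ * (w.im : ℂ) ^ n) *
      (starRingEnd ℂ) (Riter (-n) n f w)) _ z :=
    (((hasFDerivAt_im z).pow n).const_mul _).mul
      (conjCLE.toContinuousLinearMap.hasFDerivAt.comp z hh)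
  have hR : Riter (-n) (n + 1) f z = 2 * I * dtau (Riter (-n) n f) z
      + ((-n + 2 * n : ℤ) : ℂ) / z.im * Riter (-n) n f z := rfl
  rw [hR, hF]
  simp only [xiop, dtauBar, dtau, du, dv, hd.fderiv]
  simp
  have hpow : (z.im : ℂ) ^ n * (n / z.im) = n * (z.im : ℂ) ^ (n - 1) := by
    cases n with
    | zero => simp
    | succ m => rw [Nat.add_sub_cancel, pow_succ]; field_simp
  rw [← hpow, map_ofNat]
  field_simp
  linear_combination -(n * Riter (-n) n f z) * I_sq

/-- for `k ≤ 0` and every smooth `f`,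
`ξ_k(𝔉_k f) = (1/(−k)!) R_k^{1−k} f = ((−4π)^{1−k}/(−k)!) D^{1−k} f`. -/
theorem stmt10 (k : ℤ) (hk : k ≤ 0) (f : ℂ → ℂ) (hf : ContDiffOn ℝ (⊤ : ℕ∞) f UH) :
    (∀ z ∈ UH,
      xiop k (flipOp k f) z
        = (1 / ((-k).toNat.factorial : ℂ)) * Riter k (1 - k).toNat f z) ∧
    (∀ z ∈ UH,
      xiop k (flipOp k f) z
        = ((-4 * (Real.pi : ℂ)) ^ (1 - k) / ((-k).toNat.factorial : ℂ)) *
            Diter (1 - k).toNat f z) := by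
  obtain ⟨n, rfl⟩ := Int.exists_eq_neg_ofNat hk
  have h₁ : (- -(n : ℤ)).toNat = n := by simp
  have h₂ : (1 - -(n : ℤ)).toNat = n + 1 := by omega
  have h₃ : 1 - -(n : ℤ) = (n + 1 : ℕ) := by push_cast; ring
  rw [h₁, h₂, h₃, zpow_natCast]
  refine ⟨fun z hz => xiop_flipOp n hf hz, fun z hz => ?_⟩
  rw [xiop_flipOp n hf hz, Riter_neg_eq_iterate n hf hz, iterate_Rop_zero_eq_Diter]
  ring
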